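/- There is an absolute constant C such that for every integer ρ ≥ 1 and all integers b₁, b₂, b₃, b₄ coprime to q = ρ², one has |G_q(b₁,b₂,b₃,b₄)| ≤ C q^{5/2} N₁(ρ), where N₁(ρ) is the number of tuples (s, s₁, s₂, s₃, s₄) of residues modulo ρ, each coprime to ρ, satisfying s₁ + s₂ + s₃ + s₄ ≡ 0 (mod ρ) and s sᵢ² ≡ b̄ᵢ (mod ρ) for i = 1, 2, 3, 4, with b̄ᵢ the multiplicative inverse of bᵢ modulo ρ. -/

import Mathlib

/-- `e_q(x) = exp(2πi x / q)`. -/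
noncomputable def eInt (q : ℕ) (x : ℤ) : ℂ := Complex.exp (2 * Real.pi * Complex.I * x / q)

/-- A natural-number representative of the multiplicative inverse of `x` modulo `q`. -/
noncomputable def invMod (q : ℕ) (x : ℤ) : ℕ := (((x : ZMod q))⁻¹).val

/-- The Kloosterman sum `S(a,b;q) = ∑_{x mod q, (x,q)=1} e_q(a x + b x̄)`. -/
noncomputable def Kloos (q : ℕ) (a b : ℤ) : ℂ :=
  ∑ x ∈ (Finset.range q).filter (fun x => Nat.Coprime x q), eInt q (a * x + b * invMod q x)

/-- `G_q(b₁,b₂,b₃,b₄) = ∑_{h mod q} S(h,b̄₁;q) S(h,b̄₂;q) S(h,b̄₃;q) S(h,b̄₄;q)`. -/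
noncomputable def Gquad (q : ℕ) (b₁ b₂ b₃ b₄ : ℤ) : ℂ :=
  ∑ h ∈ Finset.range q,
    Kloos q h (invMod q b₁) * Kloos q h (invMod q b₂) *
      Kloos q h (invMod q b₃) * Kloos q h (invMod q b₄)

/-- `N₁(ρ)`: the number of tuples `(s,s₁,s₂,s₃,s₄)` of residues mod `ρ`, coprime to `ρ`,
with `s₁+s₂+s₃+s₄ ≡ 0 (mod ρ)` and `s sᵢ² ≡ b̄ᵢ (mod ρ)`. -/
noncomputable def N1 (ρ : ℕ) (b : Fin 4 → ℤ) : ℕ :=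
  Nat.card {t : ZMod ρ × (Fin 4 → ZMod ρ) //
    IsUnit t.1 ∧ (∀ i, IsUnit (t.2 i)) ∧ (∑ i, t.2 i = 0) ∧
      ∀ i, t.1 * (t.2 i) ^ 2 = ((b i : ZMod ρ))⁻¹}

open Finset

section ReductionModSquare

variable {ρ : ℕ}

/-- Reduction from residues modulo `ρ ^ 2` to residues modulo `ρ`. -/
noncomputable def redSq (ρ : ℕ) : ZMod (ρ ^ 2) →+* ZMod ρ :=
  ZMod.castHom (dvd_pow_self ρ two_ne_zero) (ZMod ρ)

lemma natCast_sq_eq_zero : (ρ : ZMod (ρ ^ 2)) ^ 2 = 0 := by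
  rw [← Nat.cast_pow, ZMod.natCast_self]

variable [NeZero ρ]

lemma natCast_mul_eq_zero_iff_redSq (g : ZMod (ρ ^ 2)) :
    (ρ : ZMod (ρ ^ 2)) * g = 0 ↔ redSq ρ g = 0 := by
  obtain ⟨n, rfl⟩ : ∃ n : ℕ, (n : ZMod (ρ ^ 2)) = g := ⟨g.val, ZMod.natCast_zmod_val g⟩
  rw [map_natCast, ← Nat.cast_mul, ZMod.natCast_eq_zero_iff, ZMod.natCast_eq_zero_iff, pow_two]
  exact Nat.mul_dvd_mul_iff_left (Nat.pos_of_ne_zero (NeZero.ne ρ))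

lemma sum_stdAddChar_mul (g : ZMod (ρ ^ 2)) :
    ∑ v ∈ range ρ, ZMod.stdAddChar ((ρ : ZMod (ρ ^ 2)) * (v : ZMod (ρ ^ 2)) * g) =
      if redSq ρ g = 0 then (ρ : ℂ) else 0 := by
  have key : ∀ v : ℕ, ZMod.stdAddChar ((ρ : ZMod (ρ ^ 2)) * (v : ZMod (ρ ^ 2)) * g) =
      ZMod.stdAddChar ((ρ : ZMod (ρ ^ 2)) * g) ^ v := fun v => by
    rw [← AddChar.map_nsmul_eq_pow, nsmul_eq_mul]
    congr 1
    ring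
  simp_rw [key]
  split_ifs with h
  · simp [(natCast_mul_eq_zero_iff_redSq g).2 h]
  · have hne : ZMod.stdAddChar ((ρ : ZMod (ρ ^ 2)) * g) ≠ 1 := fun h1 =>
      h ((natCast_mul_eq_zero_iff_redSq g).1
        (ZMod.injective_stdAddChar (h1.trans (AddChar.map_zero_eq_one _).symm)))
    rw [geom_sum_eq hne, ← key, ← pow_two, natCast_sq_eq_zero]
    simp

/-- If `f` is multiplied by `ψ (ρ v g)` under a family of permutations indexed by `v`, then
only the points with `g ≡ 0` modulo `ρ` contribute to the sum of `f`. -/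
lemma sum_eq_sum_ite_of_twist {X : Type*} [Fintype X] (f : X → ℂ) (g : X → ZMod (ρ ^ 2))
    (σ : ℕ → Equiv.Perm X)
    (h : ∀ (v : ℕ) x, f (σ v x) =
      f x * ZMod.stdAddChar ((ρ : ZMod (ρ ^ 2)) * (v : ZMod (ρ ^ 2)) * g x)) :
    ∑ x, f x = ∑ x, if redSq ρ (g x) = 0 then f x else 0 := by
  have hρ : (ρ : ℂ) ≠ 0 := Nat.cast_ne_zero.2 (NeZero.ne ρ)
  apply mul_left_cancel₀ hρ
  calc (ρ : ℂ) * ∑ x, f x = ∑ v ∈ range ρ, ∑ x, f (σ v x) := by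
        simp [fun v => Equiv.sum_comp (σ v) f]
    _ = ∑ x, f x * ∑ v ∈ range ρ,
          ZMod.stdAddChar ((ρ : ZMod (ρ ^ 2)) * (v : ZMod (ρ ^ 2)) * g x) := by
        rw [sum_comm]
        simp_rw [h, mul_sum]
    _ = _ := by
        simp_rw [sum_stdAddChar_mul, mul_sum, mul_ite, mul_zero, mul_comm]

/-- The unit `1 + ρ v` of `ZMod (ρ ^ 2)`. -/
noncomputable def oneAddUnit (ρ v : ℕ) : (ZMod (ρ ^ 2))ˣ where
  val := 1 + ρ * v
  inv := 1 - ρ * v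
  val_inv := by linear_combination (-(v : ZMod (ρ ^ 2)) ^ 2) * natCast_sq_eq_zero (ρ := ρ)
  inv_val := by linear_combination (-(v : ZMod (ρ ^ 2)) ^ 2) * natCast_sq_eq_zero (ρ := ρ)

lemma sum_units_stdAddChar (h c : ZMod (ρ ^ 2)) :
    ∑ x : (ZMod (ρ ^ 2))ˣ, ZMod.stdAddChar (h * x.val + c * (x⁻¹).val) =
      ∑ x : (ZMod (ρ ^ 2))ˣ, if redSq ρ (h * x.val - c * (x⁻¹).val) = 0 then
        ZMod.stdAddChar (h * x.val + c * (x⁻¹).val) else 0 := by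
  refine sum_eq_sum_ite_of_twist _ (fun x : (ZMod (ρ ^ 2))ˣ => h * x.val - c * (x⁻¹).val)
    (fun v => Equiv.mulRight (oneAddUnit ρ v)) fun v x => ?_
  rw [← AddChar.map_add_eq_mul]
  congr 1
  have h1 : ((oneAddUnit ρ v : (ZMod (ρ ^ 2))ˣ) : ZMod (ρ ^ 2)) = 1 + ρ * v := rfl
  have h2 : (((oneAddUnit ρ v)⁻¹ : (ZMod (ρ ^ 2))ˣ) : ZMod (ρ ^ 2)) = 1 - ρ * v := rfl
  simp only [Equiv.coe_mulRight, mul_inv, Units.val_mul, h1, h2]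
  ring

lemma redSq_eq_and_div_eq {x y : ZMod (ρ ^ 2)} (h : redSq ρ x = redSq ρ y)
    (h' : x.val / ρ = y.val / ρ) : x = y := by
  apply ZMod.val_injective
  have hm : x.val % ρ = y.val % ρ := by
    rw [← ZMod.natCast_zmod_val x, ← ZMod.natCast_zmod_val y, map_natCast, map_natCast,
      ZMod.natCast_eq_natCast_iff'] at h
    exact h
  rw [← Nat.div_add_mod x.val ρ, ← Nat.div_add_mod y.val ρ, h', hm]

/-- The quotient by `ρ` of the canonical representative. -/
noncomputable def quotSq (x : ZMod (ρ ^ 2)) : Fin ρ :=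
  ⟨x.val / ρ, Nat.div_lt_of_lt_mul (by simpa [pow_two] using ZMod.val_lt x)⟩

lemma card_solutions_le (c : Fin 4 → ZMod (ρ ^ 2)) (hc : ∀ i, IsUnit (c i)) (b : Fin 4 → ℤ)
    (hb : ∀ i, redSq ρ (c i) = ((b i : ZMod ρ))⁻¹) :
    Nat.card {t : ZMod (ρ ^ 2) × (Fin 4 → (ZMod (ρ ^ 2))ˣ) //
      redSq ρ (∑ i, (t.2 i : ZMod (ρ ^ 2))) = 0 ∧
        ∀ i, redSq ρ (t.1 * (t.2 i).val - c i * ((t.2 i)⁻¹).val) = 0} ≤ N1 ρ b * ρ ^ 5 := by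
  have hsol : ∀ (h : ZMod (ρ ^ 2)) (x : (ZMod (ρ ^ 2))ˣ) (i : Fin 4),
      redSq ρ (h * x.val - c i * (x⁻¹).val) = 0 →
      redSq ρ h * redSq ρ x ^ 2 = ((b i : ZMod ρ))⁻¹ := fun h x i hx => by
    have hxx : redSq ρ x.val * redSq ρ (x⁻¹).val = 1 := by rw [← map_mul]; simp
    rw [← hb]
    rw [map_sub, map_mul, map_mul] at hx
    linear_combination redSq ρ x * hx + redSq ρ (c i) * hxx
  have hunit : ∀ (h : ZMod (ρ ^ 2)) (x : (ZMod (ρ ^ 2))ˣ) (i : Fin 4),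
      redSq ρ (h * x.val - c i * (x⁻¹).val) = 0 → IsUnit (redSq ρ h) := fun h x i hx => by
    have := hsol h x i hx
    rw [← hb] at this
    exact isUnit_of_mul_isUnit_left (this ▸ (hc i).map (redSq ρ))
  have hcard : N1 ρ b * ρ ^ 5 = Nat.card ({t : ZMod ρ × (Fin 4 → ZMod ρ) //
      IsUnit t.1 ∧ (∀ i, IsUnit (t.2 i)) ∧ (∑ i, t.2 i = 0) ∧
      ∀ i, t.1 * (t.2 i) ^ 2 = ((b i : ZMod ρ))⁻¹} × (Fin ρ × (Fin 4 → Fin ρ))) := by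
    rw [Nat.card_prod, N1]
    congr 1
    simp
    ring
  rw [hcard]
  refine Nat.card_le_card_of_injective (fun t =>
    (⟨(redSq ρ t.1.1, fun i => redSq ρ (t.1.2 i)), hunit _ _ 0 (t.2.2 0),
      fun i => (t.1.2 i).isUnit.map _, by simpa using t.2.1, fun i => hsol _ _ i (t.2.2 i)⟩,
      quotSq t.1.1, fun i => quotSq (t.1.2 i : ZMod (ρ ^ 2)))) ?_
  rintro ⟨⟨h, x⟩, _⟩ ⟨⟨k, y⟩, _⟩ heq
  simp only [Prod.mk.injEq, Subtype.mk.injEq, funext_iff, quotSq, Fin.mk.injEq] at heq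
  obtain ⟨⟨h1, h2⟩, h3, h4⟩ := heq
  simp only [Subtype.mk.injEq, Prod.mk.injEq]
  exact ⟨redSq_eq_and_div_eq h1 h3,
    funext fun i => Units.ext (redSq_eq_and_div_eq (h2 i) (h4 i))⟩

lemma norm_sum_prod_le (c : Fin 4 → ZMod (ρ ^ 2)) :
    ‖∑ h : ZMod (ρ ^ 2), ∏ i,
      ∑ x : (ZMod (ρ ^ 2))ˣ, ZMod.stdAddChar (h * x.val + c i * (x⁻¹).val)‖ ≤
      Nat.card {t : ZMod (ρ ^ 2) × (Fin 4 → (ZMod (ρ ^ 2))ˣ) //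
        redSq ρ (∑ i, (t.2 i : ZMod (ρ ^ 2))) = 0 ∧
          ∀ i, redSq ρ (t.1 * (t.2 i).val - c i * ((t.2 i)⁻¹).val) = 0} := by
  classical
  let F : ZMod (ρ ^ 2) × (Fin 4 → (ZMod (ρ ^ 2))ˣ) → ℂ := fun t =>
    ∏ i, if redSq ρ (t.1 * (t.2 i).val - c i * ((t.2 i)⁻¹).val) = 0 then
      ZMod.stdAddChar (t.1 * (t.2 i).val + c i * ((t.2 i)⁻¹).val) else 0
  have hF : ∑ h : ZMod (ρ ^ 2), ∏ i,
      ∑ x : (ZMod (ρ ^ 2))ˣ, ZMod.stdAddChar (h * x.val + c i * (x⁻¹).val) = ∑ t, F t := by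
    simp_rw [sum_units_stdAddChar, prod_univ_sum, Fintype.piFinset_univ, F,
      Fintype.sum_prod_type]
  have hred : ∀ v : ℕ, redSq ρ ((ρ : ZMod (ρ ^ 2)) * v) = 0 := fun v => by simp
  rw [hF, sum_eq_sum_ite_of_twist F (fun t => ∑ i, (t.2 i : ZMod (ρ ^ 2)))
    (fun v => (Equiv.addRight ((ρ : ZMod (ρ ^ 2)) * v)).prodCongr (Equiv.refl _))]
  · rw [Nat.card_eq_fintype_card, Fintype.card_subtype, ← sum_filter, card_filter, Nat.cast_sum,
      sum_filter]
    refine (norm_sum_le _ _).trans (sum_le_sum fun t _ => ?_)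
    by_cases h1 : redSq ρ (∑ i, (t.2 i : ZMod (ρ ^ 2))) = 0
    · by_cases h2 : ∀ i, redSq ρ (t.1 * (t.2 i).val - c i * ((t.2 i)⁻¹).val) = 0
      · simp only [F, h1, h2, implies_true, and_self, if_true, norm_prod, AddChar.norm_apply]
        simp
      · obtain ⟨i, hi⟩ := not_forall.1 h2
        have : F t = 0 := prod_eq_zero (mem_univ i) (if_neg hi)
        rw [this, ite_self, norm_zero]
        positivity
    · rw [if_neg h1, norm_zero]
      positivity
  · rintro v ⟨h, x⟩
    have hx : ∀ i, redSq ρ ((h + (ρ : ZMod (ρ ^ 2)) * (v : ZMod (ρ ^ 2))) * (x i).val -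
        c i * ((x i)⁻¹).val) =
        redSq ρ (h * (x i).val - c i * ((x i)⁻¹).val) := fun i => by
      rw [map_sub, map_mul, map_add, hred, add_zero, ← map_mul, ← map_sub]
    have hprod : ZMod.stdAddChar ((ρ : ZMod (ρ ^ 2)) * (v : ZMod (ρ ^ 2)) *
        ∑ i, (x i : ZMod (ρ ^ 2))) =
        ∏ i, ZMod.stdAddChar ((ρ : ZMod (ρ ^ 2)) * (v : ZMod (ρ ^ 2)) * (x i).val) := by
      rw [mul_sum, Fin.sum_univ_four, Fin.prod_univ_four]
      simp only [AddChar.map_add_eq_mul]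
    simp only [F, Equiv.prodCongr_apply, Prod.map, Equiv.coe_addRight, Equiv.refl_apply, hx,
      hprod, ← prod_mul_distrib]
    refine prod_congr rfl fun i _ => ?_
    split_ifs
    · rw [← AddChar.map_add_eq_mul]
      congr 1
      ring
    · simp

end ReductionModSquare

section StandardCharacter

variable {q : ℕ} [NeZero q]

lemma eInt_eq_stdAddChar (x : ℤ) : eInt q x = ZMod.stdAddChar (x : ZMod q) := by
  rw [ZMod.stdAddChar_coe, eInt]

lemma natCast_invMod (x : ℤ) : (invMod q x : ZMod q) = (x : ZMod q)⁻¹ :=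
  ZMod.natCast_zmod_val _

lemma Kloos_eq_sum_units (a b : ℤ) :
    Kloos q a b =
      ∑ x : (ZMod q)ˣ, ZMod.stdAddChar ((a : ZMod q) * x.val + (b : ZMod q) * (x⁻¹).val) := by
  symm
  refine sum_bij (fun x _ => (x : ZMod q).val) (fun x _ => ?_) (fun x _ y _ hxy => ?_)
    (fun n hn => ?_) (fun x _ => ?_)
  · simpa using ⟨ZMod.val_lt _, ZMod.val_coe_unit_coprime x⟩
  · exact Units.ext (ZMod.val_injective q hxy)
  · rw [mem_filter, mem_range] at hn
    exact ⟨ZMod.unitOfCoprime n hn.2, mem_univ _, by simp [ZMod.val_cast_of_lt hn.1]⟩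
  · rw [eInt_eq_stdAddChar]
    push_cast [natCast_invMod]
    simp [ZMod.inv_coe_unit]

lemma Gquad_eq_sum (b₁ b₂ b₃ b₄ : ℤ) :
    Gquad q b₁ b₂ b₃ b₄ = ∑ h : ZMod q, ∏ i,
      ∑ x : (ZMod q)ˣ, ZMod.stdAddChar (h * x.val +
        ((![b₁, b₂, b₃, b₄] i : ℤ) : ZMod q)⁻¹ * (x⁻¹).val) := by
  symm
  refine sum_bij (fun h _ => h.val) (fun h _ => ?_) (fun h _ k _ hk => ?_)
    (fun n hn => ?_) (fun h _ => ?_)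
  · simpa using ZMod.val_lt h
  · exact ZMod.val_injective q hk
  · exact ⟨n, mem_univ _, ZMod.val_cast_of_lt (mem_range.1 hn)⟩
  · simp [Fin.prod_univ_four, Kloos_eq_sum_units, natCast_invMod]

end StandardCharacter

/-- There is an absolute constant `C` such that for every `ρ ≥ 1`, `q = ρ²` and `b₁,…,b₄`
coprime to `q`, one has `|G_q(b₁,b₂,b₃,b₄)| ≤ C q^{5/2} N₁(ρ)`. -/
theorem Gquad_square_bound :
    ∃ C : ℝ, ∀ ρ : ℕ, 1 ≤ ρ → ∀ b : Fin 4 → ℤ, (∀ i, Int.gcd (b i) (ρ ^ 2) = 1) →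
      ‖Gquad (ρ ^ 2) (b 0) (b 1) (b 2) (b 3)‖ ≤
        C * ((ρ ^ 2 : ℕ) : ℝ) ^ ((5 : ℝ) / 2) * (N1 ρ b : ℝ) := by
  refine ⟨1, fun ρ hρ b hb => ?_⟩
  have : NeZero ρ := ⟨by omega⟩
  have hunit : ∀ i, IsUnit (b i : ZMod (ρ ^ 2)) := fun i => by
    rw [ZMod.coe_int_isUnit_iff_isCoprime, Int.isCoprime_iff_gcd_eq_one, Int.gcd_comm]
    exact_mod_cast hb i
  have hinv : ∀ i, (b i : ZMod (ρ ^ 2)) * (b i : ZMod (ρ ^ 2))⁻¹ = 1 := fun i =>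
    ZMod.mul_inv_of_unit _ (hunit i)
  have hred : ∀ i, redSq ρ ((b i : ZMod (ρ ^ 2))⁻¹) = (b i : ZMod ρ)⁻¹ := fun i => by
    have h1 : (b i : ZMod ρ) * redSq ρ ((b i : ZMod (ρ ^ 2))⁻¹) = 1 := by
      rw [← map_intCast (redSq ρ), ← map_mul, hinv, map_one]
    exact (ZMod.inv_eq_of_mul_eq_one ρ _ _ h1).symm
  have hvec : ![b 0, b 1, b 2, b 3] = b := by
    ext i
    fin_cases i <;> rfl
  have hpow : ((ρ ^ 2 : ℕ) : ℝ) ^ ((5 : ℝ) / 2) = (ρ : ℝ) ^ 5 := by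
    rw [Nat.cast_pow, ← Real.rpow_natCast, ← Real.rpow_mul (Nat.cast_nonneg ρ),
      ← Real.rpow_natCast]
    norm_num
  rw [Gquad_eq_sum, hvec, hpow, one_mul, mul_comm]
  refine (norm_sum_prod_le fun i => (b i : ZMod (ρ ^ 2))⁻¹).trans ?_
  exact_mod_cast card_solutions_le _ (fun i => IsUnit.of_mul_eq_one_right _ (hinv i)) b hred
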